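/- arXiv:1012.3053 — 3 statements merged into one kernel-verified Lean document; each statement's English description precedes it below -/
import Mathlib

section
/- For 2 ≤ k ≤ d+1, the tropical hypersimplex Δ_k^d is the intersection of its d+1 cornered halfspaces H(e_i,{i}), i ∈ [d+1], and the tropical halfspaces H(0,I) over all subsets I ⊆ [d+1] with |I| = d−k+2; explicitly, Δ_k^d = { x ∈ 𝕋^d : min_{i∈I} x_i ≤ min_{j∈[d+1]∖I} x_j for every I ⊆ [d+1] with |I| = d−k+2, and x_i − 1 ≤ min_{j≠i} x_j for every i ∈ [d+1] }. -/
open Finset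

noncomputable section

variable {d n : ℕ}

/-- `x ∈ tconv {v i}`, at the level of representatives in `ℝ^{d+1}` modulo constants. -/
def InTconv {ι : Type*} (v : ι → Fin (d + 1) → ℝ) (x : Fin (d + 1) → ℝ) : Prop :=
  ∃ (lam : ι → ℝ) (c : ℝ), ∀ j, x j + c = ⨅ i, (lam i + v i j)

/-- the `k`-th entry of the type of `x` with respect to the generators `v` -/
def typeEntry {ι : Type*} (v : ι → Fin (d + 1) → ℝ) (x : Fin (d + 1) → ℝ)
    (k : Fin (d + 1)) : Set ι :=
  {i | v i k - x k = ⨅ j, (v i j - x j)}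

/-- the spanning subgraph of `G` whose edges are those indexed by `B` -/
def edgeGraph {W : Type*} (G : SimpleGraph W) (ε : Fin (d + 1) ≃ G.edgeSet)
    (B : Finset (Fin (d + 1))) : SimpleGraph W :=
  SimpleGraph.fromEdgeSet {s | ∃ i ∈ B, (ε i : Sym2 W) = s}

/-- `B ⊆ [d+1]` is the edge set of a spanning tree of `G` -/
def IsSpanningTreeEdges {W : Type*} (G : SimpleGraph W) (ε : Fin (d + 1) ≃ G.edgeSet)
    (B : Finset (Fin (d + 1))) : Prop :=
  (edgeGraph G ε B).IsTree

/-- generators of the tropical matroid polytope, in canonical coordinates -/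
def gen (Bs : Fin n → Finset (Fin (d + 1))) (l : Fin n) (i : Fin (d + 1)) : ℝ :=
  if i ∈ Bs l then 0 else 1

/-- data of the cycle matroid of a connected bridgeless simple graph `G` whose `d+1` edges are
enumerated by `ε` and whose bases (spanning-tree edge sets, each of rank/cardinality `k`) are
enumerated without repetition by `Bs`. -/
structure MatroidData (d n k : ℕ) (W : Type) (G : SimpleGraph W)
    (ε : Fin (d + 1) ≃ G.edgeSet) (Bs : Fin n → Finset (Fin (d + 1))) : Prop where
  connected : G.Connected
  bridgeless : ∀ i : Fin (d + 1), ¬ G.IsBridge (ε i : Sym2 W)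
  tree : ∀ l, IsSpanningTreeEdges G ε (Bs l)
  inj : Function.Injective Bs
  all : ∀ B : Finset (Fin (d + 1)), IsSpanningTreeEdges G ε B → ∃ l, Bs l = B
  card : ∀ l, (Bs l).card = k

/-- minimum of `f` over a subset of coordinates (as an infimum) -/
def tmin (I : Set (Fin (d + 1))) (f : Fin (d + 1) → ℝ) : ℝ := sInf (f '' I)

/-- the closed tropical halfspace with apex `p` and type `I` -/
def Halfspace (p : Fin (d + 1) → ℝ) (I : Set (Fin (d + 1))) : Set (Fin (d + 1) → ℝ) :=
  {x | tmin I (fun i => x i - p i) ≤ tmin Iᶜ (fun j => x j - p j)}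

/-- the closed cell of the tropical complex containing `p` -/
def closedCell {ι : Type*} (v : ι → Fin (d + 1) → ℝ) (p : Fin (d + 1) → ℝ) :
    Set (Fin (d + 1) → ℝ) :=
  {x | ∀ k, typeEntry v p k ⊆ typeEntry v x k}

/-- the (closed) cells of the tropical complex `𝒞_V` -/
def IsCell {ι : Type*} (v : ι → Fin (d + 1) → ℝ) (X : Set (Fin (d + 1) → ℝ)) : Prop :=
  ∃ p, X = closedCell v p

/-- the chart `c₀ : 𝕋^d → ℝ^d` -/
def chart (x : Fin (d + 1) → ℝ) (i : Fin d) : ℝ := x i.succ - x 0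

/-- a bounded cell of the tropical complex (bounded as a subset of `𝕋^d ≅ ℝ^d`) -/
def IsBoundedCell {ι : Type*} (v : ι → Fin (d + 1) → ℝ) (X : Set (Fin (d + 1) → ℝ)) : Prop :=
  IsCell v X ∧ Bornology.IsBounded (chart '' X)

/-- an inclusion-maximal bounded cell -/
def IsMaxBoundedCell {ι : Type*} (v : ι → Fin (d + 1) → ℝ) (X : Set (Fin (d + 1) → ℝ)) : Prop :=
  IsBoundedCell v X ∧ ∀ Y, IsBoundedCell v Y → X ⊆ Y → Y = X

/-- an inclusion-maximal cell -/
def IsMaxCell {ι : Type*} (v : ι → Fin (d + 1) → ℝ) (X : Set (Fin (d + 1) → ℝ)) : Prop :=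
  IsCell v X ∧ ∀ Y, IsCell v Y → X ⊆ Y → Y = X

/-- a point of the relative interior of a cell `X`: a point of `X` whose type is
componentwise contained in the type of every point of `X` -/
def IsInteriorPoint {ι : Type*} (v : ι → Fin (d + 1) → ℝ) (X : Set (Fin (d + 1) → ℝ))
    (x : Fin (d + 1) → ℝ) : Prop :=
  x ∈ X ∧ ∀ y ∈ X, ∀ k, typeEntry v x k ⊆ typeEntry v y k

/-- `b_{I,J}`: the number of bases `B` with `I ⊆ B` and `J ∩ B = ∅` -/
def bIJ (Bs : Fin n → Finset (Fin (d + 1))) (I J : Finset (Fin (d + 1))) : ℕ :=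
  (Finset.univ.filter fun l => I ⊆ Bs l ∧ Disjoint J (Bs l)).card

/-- a pseudovertex of the tropical complex: the unique point of `𝕋^d` of its type -/
def IsPseudovertex {ι : Type*} (v : ι → Fin (d + 1) → ℝ) (x : Fin (d + 1) → ℝ) : Prop :=
  ∀ y, (∀ k, typeEntry v y k = typeEntry v x k) → ∃ c : ℝ, y = fun j => x j + c

/-- the pseudovertex `e_{i₁,…,i_s} = -e_J`, `J = [d+1] ∖ {σ 0,…,σ (s-1)}`, in canonical
coordinates: coordinate `1` at `σ 0, …, σ (s-1)` and `0` elsewhere -/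
def ptSeq {r : ℕ} (σ : Fin r → Fin (d + 1)) (s : ℕ) (j : Fin (d + 1)) : ℝ :=
  if ∃ t : Fin r, (t : ℕ) < s ∧ σ t = j then 1 else 0

/-- the generators `-e_I`, `|I| = k`, of the tropical hypersimplex `Δ_k^d`, in
canonical coordinates -/
def genU (d k : ℕ) : {I : Finset (Fin (d + 1)) // I.card = k} → Fin (d + 1) → ℝ :=
  fun I j => if j ∈ I.1 then 0 else 1

theorem tmin_le_tmin_iff {I J : Set (Fin (d + 1))} (hI : I.Nonempty) (hJ : J.Nonempty)
    (f g : Fin (d + 1) → ℝ) : tmin I f ≤ tmin J g ↔ ∀ j ∈ J, ∃ i ∈ I, f i ≤ g j := by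
  have bdd : ∀ (K : Set (Fin (d + 1))) (h : Fin (d + 1) → ℝ), BddBelow (h '' K) :=
    fun K h => (K.toFinite.image h).bddBelow
  constructor
  · intro h j hj
    obtain ⟨i, hi, hfi⟩ := (hI.image f).csInf_mem (I.toFinite.image f)
    refine ⟨i, hi, hfi.trans_le (h.trans ?_)⟩
    exact csInf_le (bdd J g) ⟨j, hj, rfl⟩
  · intro h
    refine le_csInf (hJ.image g) ?_
    rintro _ ⟨j, hj, rfl⟩
    obtain ⟨i, hi, hij⟩ := h j hj
    exact (csInf_le (bdd I f) ⟨i, hi, rfl⟩).trans hij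

theorem compl_singleton_nonempty (hd : 1 ≤ d) (i : Fin (d + 1)) :
    ({i}ᶜ : Set (Fin (d + 1))).Nonempty := by
  have : Nontrivial (Fin (d + 1)) := Fin.nontrivial_iff_two_le.2 (by omega)
  obtain ⟨j, hj⟩ := exists_ne i
  exact ⟨j, hj⟩

theorem mem_halfspace_singleton_iff (hd : 1 ≤ d) (i : Fin (d + 1)) (x : Fin (d + 1) → ℝ) :
    x ∈ Halfspace (fun j => if j = i then (1 : ℝ) else 0) {i} ↔ ∀ j, x i - 1 ≤ x j := by
  rw [Halfspace, Set.mem_ofPred_eq,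
    tmin_le_tmin_iff (Set.singleton_nonempty i) (compl_singleton_nonempty hd i)]
  constructor
  · intro h j
    by_cases hj : j = i
    · subst hj
      linarith
    · simpa [hj] using h j hj
  · intro h j hj
    have hj' : j ≠ i := hj
    exact ⟨i, rfl, by simpa [hj'] using h j⟩

theorem sub_one_le_tmin_iff (hd : 1 ≤ d) (i : Fin (d + 1)) (x : Fin (d + 1) → ℝ) :
    x i - 1 ≤ tmin {j | j ≠ i} x ↔ ∀ j, x i - 1 ≤ x j := by
  have h := tmin_le_tmin_iff (Set.singleton_nonempty i) (compl_singleton_nonempty hd i)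
    (fun j => x j - 1) x
  have h' : tmin {i} (fun j => x j - 1) = x i - 1 := by simp [tmin]
  rw [h'] at h
  refine h.trans ⟨fun h j => ?_, fun h j _ => ⟨i, rfl, h j⟩⟩
  by_cases hj : j = i
  · subst hj
    linarith
  · simpa using h j hj

theorem tmin_le_tmin_compl_iff {I : Finset (Fin (d + 1))} (hI : 1 ≤ I.card) (hI' : I.card ≤ d)
    (x : Fin (d + 1) → ℝ) : tmin ↑I x ≤ tmin ↑(Iᶜ) x ↔ ∀ j, ∃ i ∈ I, x i ≤ x j := by
  have h1 : (I : Set (Fin (d + 1))).Nonempty := Finset.card_pos.1 hI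
  have h2 : ((Iᶜ : Finset (Fin (d + 1))) : Set (Fin (d + 1))).Nonempty := by
    refine Finset.card_pos.1 ?_
    rw [Finset.card_compl, Fintype.card_fin]
    omega
  rw [tmin_le_tmin_iff h1 h2]
  refine ⟨fun h j => ?_, fun h j _ => h j⟩
  by_cases hj : j ∈ I
  · exact ⟨j, hj, le_rfl⟩
  · exact h j (by simpa using hj)

theorem InTconv.exists_forall_le {ι : Type*} [Finite ι] [Nonempty ι] {v : ι → Fin (d + 1) → ℝ}
    {x : Fin (d + 1) → ℝ} (hx : InTconv v x) (j : Fin (d + 1)) :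
    ∃ l, ∀ i, x i - v l i ≤ x j - v l j := by
  obtain ⟨lam, c, h⟩ := hx
  obtain ⟨l, hl⟩ := exists_eq_ciInf_of_finite (f := fun l => lam l + v l j)
  refine ⟨l, fun i => ?_⟩
  have hi : x i + c ≤ lam l + v l i :=
    (h i).trans_le (ciInf_le (Set.finite_range fun l => lam l + v l i).bddBelow l)
  have hj : x j + c = lam l + v l j := (h j).trans hl.symm
  linarith

theorem inTconv_of_exists_forall_le {ι : Type*} [Finite ι] [Nonempty ι]
    {v : ι → Fin (d + 1) → ℝ} {x : Fin (d + 1) → ℝ}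
    (h : ∀ j, ∃ l, ∀ i, x i - v l i ≤ x j - v l j) : InTconv v x := by
  refine ⟨fun l => ⨆ i, (x i - v l i), 0, fun j => ?_⟩
  rw [add_zero]
  apply le_antisymm
  · refine le_ciInf fun l => ?_
    have := le_ciSup (Set.finite_range fun i => x i - v l i).bddAbove j
    linarith
  · obtain ⟨l, hl⟩ := h j
    have h1 : (⨆ i, (x i - v l i)) ≤ x j - v l j := ciSup_le hl
    have h2 := ciInf_le (Set.finite_range fun l => (⨆ i, (x i - v l i)) + v l j).bddBelow l
    linarith

theorem inTconv_iff {ι : Type*} [Finite ι] [Nonempty ι] (v : ι → Fin (d + 1) → ℝ)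
    (x : Fin (d + 1) → ℝ) : InTconv v x ↔ ∀ j, ∃ l, ∀ i, x i - v l i ≤ x j - v l j :=
  ⟨fun hx => hx.exists_forall_le, inTconv_of_exists_forall_le⟩

theorem le_card_argmin {k : ℕ} {x : Fin (d + 1) → ℝ}
    (h : ∀ I : Finset (Fin (d + 1)), I.card = d + 2 - k → ∀ j, ∃ i ∈ I, x i ≤ x j) :
    k ≤ (univ.filter fun i => ∀ j, x i ≤ x j).card := by
  by_contra! hlt
  have hc : d + 2 - k ≤ ((univ.filter fun i => ∀ j, x i ≤ x j)ᶜ).card := by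
    rw [Finset.card_compl, Fintype.card_fin]
    omega
  obtain ⟨I, hI, hIc⟩ := Finset.exists_subset_card_eq hc
  obtain ⟨m, hm⟩ := Finite.exists_min x
  obtain ⟨i, hi, him⟩ := h I hIc m
  have := hI hi
  simp only [mem_compl, mem_filter, mem_univ, true_and] at this
  exact this fun j => him.trans (hm j)

theorem inTconv_genU_iff {k : ℕ} (hk : 1 ≤ k) (hkd : k ≤ d + 1) (x : Fin (d + 1) → ℝ) :
    InTconv (genU d k) x ↔
      (∀ I : Finset (Fin (d + 1)), I.card = d + 2 - k → ∀ j, ∃ i ∈ I, x i ≤ x j) ∧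
        ∀ i j, x i - 1 ≤ x j := by
  have : Nonempty {I : Finset (Fin (d + 1)) // I.card = k} := by
    obtain ⟨I, -, hI⟩ := Finset.exists_subset_card_eq (s := (univ : Finset (Fin (d + 1))))
      (n := k) (by simpa using hkd)
    exact ⟨⟨I, hI⟩⟩
  have gen_nonneg : ∀ l j, 0 ≤ genU d k l j := fun l j => by
    unfold genU
    split_ifs <;> norm_num
  have gen_le_one : ∀ l j, genU d k l j ≤ 1 := fun l j => by
    unfold genU
    split_ifs <;> norm_num
  rw [inTconv_iff]
  constructor
  · intro h
    refine ⟨fun I hI j => ?_, fun i j => ?_⟩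
    · obtain ⟨l, hl⟩ := h j
      have hmeet : (I ∩ l.1).Nonempty := by
        refine Finset.inter_nonempty_of_card_lt_card_add_card (subset_univ I) (subset_univ l.1) ?_
        rw [hI, l.2, Finset.card_univ, Fintype.card_fin]
        omega
      obtain ⟨i, hi⟩ := hmeet
      rw [mem_inter] at hi
      refine ⟨i, hi.1, ?_⟩
      have hi0 : genU d k l i = 0 := if_pos hi.2
      linarith [hl i, gen_nonneg l j]
    · obtain ⟨l, hl⟩ := h j
      linarith [hl i, gen_nonneg l j, gen_le_one l i]
  · rintro ⟨h, hcorner⟩ j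
    set M : Finset (Fin (d + 1)) := univ.filter fun i => ∀ j, x i ≤ x j with hM
    obtain ⟨J, hjJ, hJM, hJ⟩ : ∃ J : Finset (Fin (d + 1)), {j} ⊆ J ∧ J ⊆ insert j M ∧
        J.card = k :=
      Finset.exists_subsuperset_card_eq (by simp) (by simpa using hk)
        ((le_card_argmin h).trans (card_le_card (subset_insert j M)))
    have hj0 : genU d k ⟨J, hJ⟩ j = 0 := if_pos (singleton_subset_iff.1 hjJ)
    refine ⟨⟨J, hJ⟩, fun i => ?_⟩
    rw [hj0, sub_zero]
    by_cases hi : i ∈ J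
    · rw [genU, if_pos hi, sub_zero]
      rcases mem_insert.1 (hJM hi) with rfl | hiM
      · exact le_rfl
      · exact (mem_filter.1 hiM).2 j
    · rw [genU, if_neg hi]
      exact hcorner i j

/-- For `2 ≤ k ≤ d+1`, the tropical hypersimplex `Δ_k^d` is the
intersection of its `d+1` cornered halfspaces `H(e_i, {i})` and the tropical halfspaces
`H(0, I)` over all `I ⊆ [d+1]` with `|I| = d-k+2`; explicitly, it is the set of `x ∈ 𝕋^d`
with `min_{i∈I} x_i ≤ min_{j∉I} x_j` for all such `I` and `x_i - 1 ≤ min_{j≠i} x_j` for all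
`i`. -/
theorem tropicalHypersimplex_eq_inter_halfspaces (d k : ℕ) (hk2 : 2 ≤ k) (hkd : k ≤ d + 1) :
    ({x : Fin (d + 1) → ℝ | InTconv (genU d k) x} =
      (⋂ i : Fin (d + 1), Halfspace (fun j => if j = i then (1 : ℝ) else 0) {i}) ∩
        ⋂ I ∈ {I : Finset (Fin (d + 1)) | I.card = d + 2 - k},
          Halfspace (0 : Fin (d + 1) → ℝ) ↑I) ∧
    {x : Fin (d + 1) → ℝ | InTconv (genU d k) x} =
      {x : Fin (d + 1) → ℝ |
        (∀ I : Finset (Fin (d + 1)), I.card = d + 2 - k → tmin ↑I x ≤ tmin ↑(Iᶜ) x) ∧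
        ∀ i : Fin (d + 1), x i - 1 ≤ tmin {j | j ≠ i} x} := by
  have hd : 1 ≤ d := by omega
  have explicit : ∀ x : Fin (d + 1) → ℝ, InTconv (genU d k) x ↔
      (∀ I : Finset (Fin (d + 1)), I.card = d + 2 - k → tmin ↑I x ≤ tmin ↑(Iᶜ) x) ∧
        ∀ i : Fin (d + 1), x i - 1 ≤ tmin {j | j ≠ i} x := fun x => by
    rw [inTconv_genU_iff (by omega) hkd]
    refine and_congr (forall₂_congr fun I hI => ?_) (forall_congr' fun i => ?_)
    · exact (tmin_le_tmin_compl_iff (by omega) (by omega) x).symm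
    · exact (sub_one_le_tmin_iff hd i x).symm
  refine ⟨?_, Set.ext explicit⟩
  ext x
  rw [Set.mem_ofPred_eq, explicit, and_comm, Set.mem_inter_iff, Set.mem_iInter, Set.mem_iInter₂]
  refine and_congr (forall_congr' fun i => ?_) (forall₂_congr fun I _ => ?_)
  · rw [sub_one_le_tmin_iff hd, mem_halfspace_singleton_iff hd]
  · simp [Halfspace]
end
end

section
/- For 2 ≤ k ≤ d+1 and every subset I ⊆ [d+1] with |I| = d−k+2, the tropical halfspace H(0,I) with apex the origin contains the tropical hypersimplex Δ_k^d and is a minimal tropical halfspace for Δ_k^d: no tropical halfspace containing Δ_k^d is properly contained in H(0,I). -/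
open Finset

noncomputable section

variable {d n : ℕ}

/-- A point lies in a proper tropical halfspace iff some coordinate in the type attains a value
at most all the coordinates outside the type. -/
theorem mem_Halfspace_iff {p x : Fin (d + 1) → ℝ} {I : Set (Fin (d + 1))} (hne : I.Nonempty)
    (hun : I ≠ Set.univ) :
    x ∈ Halfspace p I ↔ ∃ i ∈ I, ∀ j ∉ I, x i - p i ≤ x j - p j := by
  have hc : (Iᶜ).Nonempty := Set.nonempty_compl.mpr hun
  have hbdd (S : Set (Fin (d + 1))) (f : Fin (d + 1) → ℝ) : BddBelow (f '' S) :=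
    (Set.toFinite _).bddBelow
  simp only [Halfspace, tmin, Set.mem_ofPred_eq]
  constructor
  · intro h
    obtain ⟨i, hi, hie⟩ := (hne.image fun i => x i - p i).csInf_mem (Set.toFinite _)
    refine ⟨i, hi, fun j hj => ?_⟩
    exact (hie.le.trans h).trans (csInf_le (hbdd _ _) ⟨j, hj, rfl⟩)
  · rintro ⟨i, hi, h⟩
    refine (csInf_le (hbdd _ _) ⟨i, hi, rfl⟩).trans (le_csInf (hc.image _) ?_)
    rintro _ ⟨j, hj, rfl⟩
    exact h j hj

/-- The generators of a finitely generated tropical polytope belong to it. -/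
theorem inTconv_generator {ι : Type*} [Finite ι] (v : ι → Fin (d + 1) → ℝ) (a : ι) :
    InTconv v (v a) := by
  have hbdd (f : ι → ℝ) : BddBelow (Set.range f) := (Set.finite_range f).bddBelow
  refine ⟨fun i => ⨆ l, (v a l - v i l), 0, fun j => ?_⟩
  have : Nonempty ι := ⟨a⟩
  refine le_antisymm (le_ciInf fun i => ?_) ((ciInf_le (hbdd _) a).trans ?_)
  · have := le_ciSup (f := fun l => v a l - v i l) (Set.finite_range _).bddAbove j
    linarith
  · simp

/-- Inclusion of proper tropical halfspaces, tested on points concentrated at one coordinate: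
the type shrinks, and `p - q` is smaller on the inner type than off the outer type. -/
theorem Halfspace_subset_necessary {p q : Fin (d + 1) → ℝ} {I I' : Set (Fin (d + 1))}
    (hI : I.Nonempty) (hIu : I ≠ Set.univ) (hIu' : I' ≠ Set.univ)
    (h : Halfspace p I' ⊆ Halfspace q I) {i : Fin (d + 1)} (hi : i ∈ I') :
    i ∈ I ∧ ∀ j ∉ I, p i - q i ≤ p j - q j := by
  classical
  obtain ⟨B, hB⟩ := (Set.finite_range fun a => |p a - q a|).bddAbove
  replace hB : ∀ a, |p a - q a| ≤ B := fun a => hB ⟨a, rfl⟩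
  have hB0 : 0 ≤ B := (abs_nonneg _).trans (hB i)
  obtain ⟨j₀, hj₀⟩ := (Set.ne_univ_iff_exists_notMem _).mp hIu
  let x : Fin (d + 1) → ℝ := fun a => p a + if a = i ∨ a ∉ I then 0 else 2 * B + 1
  have hx : x ∈ Halfspace p I' := by
    refine (mem_Halfspace_iff ⟨i, hi⟩ hIu').mpr ⟨i, hi, fun j _ => ?_⟩
    simp only [x, true_or, if_true]
    split_ifs <;> linarith
  obtain ⟨l, hl, hmin⟩ := (mem_Halfspace_iff hI hIu).mp (h hx)
  have hli : l = i := by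
    by_contra hne
    have h₁ := hmin j₀ hj₀
    simp only [x, hne, hl, hj₀, not_true_eq_false, not_false_eq_true, or_false, or_true, if_true,
      if_false] at h₁
    have h₂ := neg_le_of_abs_le (hB l)
    have h₃ := le_of_abs_le (hB j₀)
    linarith
  subst hli
  refine ⟨hl, fun j hj => ?_⟩
  simpa [x, hj] using hmin j hj

/-- If every `k`-subset of coordinates meets `I`, then `H(0, I)` contains the tropical
hypersimplex `Δ_k^d`. -/
theorem tropicalHypersimplex_subset_Halfspace {k : ℕ} (hkd : k ≤ d + 1) {I : Set (Fin (d + 1))}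
    (hne : I.Nonempty) (hun : I ≠ Set.univ)
    (hmeet : ∀ J : Finset (Fin (d + 1)), J.card = k → ∃ i ∈ J, i ∈ I) :
    {x : Fin (d + 1) → ℝ | InTconv (genU d k) x} ⊆ Halfspace (0 : Fin (d + 1) → ℝ) I := by
  rintro x ⟨lam, c, hx⟩
  obtain ⟨J₁, -, hJ₁⟩ := Finset.exists_subset_card_eq (s := (univ : Finset (Fin (d + 1))))
    (n := k) (by simpa using hkd)
  have : Nonempty {J : Finset (Fin (d + 1)) // J.card = k} := ⟨⟨J₁, hJ₁⟩⟩
  obtain ⟨i, hi, himin⟩ := Set.exists_min_image I x (Set.toFinite _) hne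
  refine (mem_Halfspace_iff hne hun).mpr ⟨i, hi, fun j _ => ?_⟩
  obtain ⟨J, hJ⟩ := exists_eq_ciInf_of_finite (f := fun J => lam J + genU d k J j)
  obtain ⟨l, hlJ, hlI⟩ := hmeet J.1 J.2
  have h₁ : x l + c ≤ lam J + genU d k J l :=
    (hx l).trans_le (ciInf_le (Set.finite_range _).bddBelow J)
  have h₂ : genU d k J l ≤ genU d k J j := by
    simp only [genU, hlJ, if_true]
    split_ifs <;> norm_num
  have h₃ := himin l hlI
  have h₄ := hx j
  simp only [Pi.zero_apply]
  linarith

/-- For `2 ≤ k ≤ d+1` and every `I ⊆ [d+1]` with `|I| = d-k+2`, the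
tropical halfspace `H(0, I)` contains the tropical hypersimplex `Δ_k^d` and is a minimal
tropical halfspace for it: no tropical halfspace containing `Δ_k^d` is properly contained
in `H(0, I)`. -/
theorem halfspace_minimal_tropicalHypersimplex (d k : ℕ) (hk2 : 2 ≤ k) (hkd : k ≤ d + 1)
    (I : Finset (Fin (d + 1))) (hI : I.card = d + 2 - k) :
    ({x : Fin (d + 1) → ℝ | InTconv (genU d k) x} ⊆
        Halfspace (0 : Fin (d + 1) → ℝ) ↑I) ∧
    ∀ (p : Fin (d + 1) → ℝ) (I' : Set (Fin (d + 1))), I'.Nonempty → I' ≠ Set.univ →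
      {x : Fin (d + 1) → ℝ | InTconv (genU d k) x} ⊆ Halfspace p I' →
      Halfspace p I' ⊆ Halfspace (0 : Fin (d + 1) → ℝ) ↑I →
      Halfspace p I' = Halfspace (0 : Fin (d + 1) → ℝ) ↑I := by
  have hne : (I : Set (Fin (d + 1))).Nonempty := by
    rw [Finset.coe_nonempty, ← Finset.card_pos]
    omega
  have hcard : (Iᶜ).card = k - 1 := by
    rw [Finset.card_compl, Fintype.card_fin]
    omega
  obtain ⟨j₀, hj₀⟩ : (Iᶜ).Nonempty := by
    rw [← Finset.card_pos]
    omega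
  rw [Finset.mem_compl] at hj₀
  have hun : (I : Set (Fin (d + 1))) ≠ Set.univ :=
    (Set.ne_univ_iff_exists_notMem _).mpr ⟨j₀, by simpa using hj₀⟩
  refine ⟨tropicalHypersimplex_subset_Halfspace hkd hne hun fun J hJ => ?_, ?_⟩
  · by_contra! hdisj
    have : J ⊆ Iᶜ := fun i hi => Finset.mem_compl.mpr (hdisj i hi)
    have := Finset.card_le_card this
    omega
  intro p I' hne' hun' hcontains hsub
  have hnec {i} (hi : i ∈ I') := Halfspace_subset_necessary hne hun hun' hsub hi
  have hall : ∀ i ∈ I, i ∈ I' ∧ ∀ j ∉ I, p i = p j := by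
    intro i hi
    have hJ : (insert i Iᶜ).card = k := by
      rw [Finset.card_insert_of_notMem (by simpa using hi)]
      omega
    obtain ⟨l, hl, hmin⟩ := (mem_Halfspace_iff hne' hun').mp
      (hcontains (inTconv_generator (genU d k) ⟨insert i Iᶜ, hJ⟩))
    obtain ⟨hlI, hle⟩ := hnec hl
    have hmin' : ∀ j ∉ I, genU d k ⟨insert i Iᶜ, hJ⟩ l - p l ≤ - p j := fun j hj => by
      have := hmin j fun hj' => hj (by simpa using (hnec hj').1)
      simpa [genU, hj] using this
    have hli : l = i := by
      by_contra hli
      have h₁ := hmin' j₀ hj₀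
      have h₂ := hle j₀ (by simpa using hj₀)
      have hlI' : l ∈ I := by simpa using hlI
      simp [genU, hli, hlI'] at h₁ h₂
      linarith
    subst hli
    refine ⟨hl, fun j hj => le_antisymm ?_ ?_⟩
    · simpa using hle j (by simpa using hj)
    · simpa [genU] using hmin' j hj
  have hII' : I' = I := Set.Subset.antisymm (fun i hi => (hnec hi).1) fun i hi => (hall i hi).1
  obtain ⟨i₀, hi₀⟩ := hne
  have hconst : ∀ j, p j = p j₀ := fun j => by
    by_cases hj : j ∈ I
    · exact (hall j hj).2 j₀ hj₀
    · rw [← (hall i₀ hi₀).2 j hj, (hall i₀ hi₀).2 j₀ hj₀]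
  ext x
  rw [hII', mem_Halfspace_iff ⟨i₀, hi₀⟩ hun, mem_Halfspace_iff ⟨i₀, hi₀⟩ hun]
  simp [hconst]
end
end

section
/- For each basis B_m of 𝓜, the generator −e_{B_m} is not contained in the tropical convex hull of the remaining generators {−e_{B_l} : l ∈ [n], l ≠ m}; consequently the points −e_{B_1}, …, −e_{B_n} are exactly the tropical vertices of the tropical matroid polytope P (its unique inclusion-minimal generating set). -/
open Finset

noncomputable section

variable {d n : ℕ}

/-- A generating family lies in its own tropical convex hull. -/
theorem inTconv_self {ι : Type*} [Fintype ι] (v : ι → Fin (d + 1) → ℝ) (i : ι) :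
    InTconv v (v i) := by
  have : Nonempty ι := ⟨i⟩
  refine ⟨fun l => ⨆ j, (v i j - v l j), 0, fun j => ?_⟩
  have hle : ∀ l, v i j ≤ (⨆ j, (v i j - v l j)) + v l j := fun l => by
    linarith [le_ciSup (f := fun j => v i j - v l j) (Set.finite_range _).bddAbove j]
  rw [add_zero]
  refine le_antisymm (le_ciInf hle) ?_
  refine (ciInf_le (Set.finite_range _).bddBelow i).trans_eq ?_
  simp

/-- If a translate of `-e_{B_l}` lies above `-e_{B_m}` and meets it at a coordinate of `B_m`,
then `l = m`. -/
theorem eq_of_gen_le {Bs : Fin n → Finset (Fin (d + 1))} (hinj : Function.Injective Bs)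
    {m l : Fin n} (hcard : (Bs m).card ≤ (Bs l).card) {a : ℝ} {j : Fin (d + 1)}
    (hj : j ∈ Bs m) (heq : gen Bs m j = a + gen Bs l j)
    (hle : ∀ i, gen Bs m i ≤ a + gen Bs l i) : l = m := by
  refine hinj (eq_of_subset_of_card_le (fun i hi => ?_) hcard)
  by_contra him
  have h := hle i
  simp only [gen, hj, hi, him, if_true, if_false] at heq h
  split_ifs at heq <;> linarith

theorem MatroidData.nonempty {k : ℕ} {W : Type} {G : SimpleGraph W}
    {ε : Fin (d + 1) ≃ G.edgeSet} {Bs : Fin n → Finset (Fin (d + 1))}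
    (hM : MatroidData d n k W G ε Bs) (m : Fin n) : (Bs m).Nonempty := by
  by_contra h
  have hbot : edgeGraph G ε (Bs m) = ⊥ := by
    simp [edgeGraph, not_nonempty_iff_eq_empty.mp h]
  have hconn : (edgeGraph G ε (Bs m)).Connected := (hM.tree m).connected
  obtain ⟨e, he⟩ := ε 0
  induction e with
  | h a b =>
    obtain ⟨p⟩ := hconn.preconnected a b
    rw [hbot] at p
    cases p with
    | nil => exact G.irrefl he
    | cons h _ => exact h

theorem MatroidData.exists_notMem {k : ℕ} {W : Type} {G : SimpleGraph W}
    {ε : Fin (d + 1) ≃ G.edgeSet} {Bs : Fin n → Finset (Fin (d + 1))}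
    (hM : MatroidData d n k W G ε Bs) (m : Fin n) : ∃ j, j ∉ Bs m := by
  by_contra! h
  have hG : edgeGraph G ε (Bs m) = G := by
    have hset : {s | ∃ i ∈ Bs m, (ε i : Sym2 W) = s} = G.edgeSet := by
      ext s
      refine ⟨?_, fun hs => ⟨ε.symm ⟨s, hs⟩, h _, by simp⟩⟩
      rintro ⟨i, -, rfl⟩
      exact (ε i).2
    rw [edgeGraph, hset, SimpleGraph.fromEdgeSet_edgeSet]
  have hacyc : (edgeGraph G ε (Bs m)).IsAcyclic := (hM.tree m).isAcyclic
  rw [hG, SimpleGraph.isAcyclic_iff_forall_isBridge] at hacyc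
  exact hM.bridgeless 0 (hacyc (ε 0).2)

/-- No generator `-e_{B_m}` of the tropical matroid polytope `P` lies in
the tropical convex hull of the remaining generators; consequently the points
`-e_{B_1}, …, -e_{B_n}` are exactly the tropical vertices of `P`: every finite family of
points generating `P` contains a representative of each `-e_{B_m}`. -/
theorem tropicalVertices_tropicalMatroidPolytope
    (d n k : ℕ) (W : Type) [Fintype W] (G : SimpleGraph W)
    (ε : Fin (d + 1) ≃ G.edgeSet) (Bs : Fin n → Finset (Fin (d + 1)))
    (hM : MatroidData d n k W G ε Bs) :
    (∀ m : Fin n,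
      ¬ InTconv (fun l : {l : Fin n // l ≠ m} => gen Bs l.1) (gen Bs m)) ∧
    ∀ (ι : Type) [Fintype ι] [Nonempty ι] (w : ι → Fin (d + 1) → ℝ),
      {x : Fin (d + 1) → ℝ | InTconv w x} = {x : Fin (d + 1) → ℝ | InTconv (gen Bs) x} →
      ∀ m : Fin n, ∃ (i : ι) (c : ℝ), w i = fun j => gen Bs m j + c := by
  refine ⟨fun m => ?_, fun ι _ _ w hw m => ?_⟩
  · rintro ⟨lam, c, h⟩
    obtain ⟨j, hj⟩ := hM.nonempty m
    rcases isEmpty_or_nonempty {l : Fin n // l ≠ m} with _ | _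
    · obtain ⟨i, hi⟩ := hM.exists_notMem m
      have h₁ := h i
      have h₂ := h j
      simp only [gen, hi, hj, if_true, if_false, Real.iInf_of_isEmpty] at h₁ h₂
      linarith
    · obtain ⟨l, hl⟩ := exists_eq_ciInf_of_finite (f := fun l => lam l + gen Bs l.1 j)
      refine l.2 (eq_of_gen_le hM.inj (by rw [hM.card, hM.card]) (a := lam l - c) hj ?_ fun i => ?_)
      · linarith [h j]
      · linarith [h i, ciInf_le (f := fun l => lam l + gen Bs l.1 i)
          (Set.finite_range _).bddBelow l]
  · have : Nonempty (Fin n) := ⟨m⟩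
    obtain ⟨j, hj⟩ := hM.nonempty m
    obtain ⟨mu, c, h⟩ : InTconv w (gen Bs m) := hw.superset (inTconv_self (gen Bs) m)
    obtain ⟨i, hi⟩ := exists_eq_ciInf_of_finite (f := fun i => mu i + w i j)
    obtain ⟨lam, b, hb⟩ : InTconv (gen Bs) (w i) := hw.subset (inTconv_self w i)
    obtain ⟨l, hl⟩ := exists_eq_ciInf_of_finite (f := fun l => lam l + gen Bs l j)
    have hlow : ∀ s, gen Bs m s + c ≤ mu i + w i s := fun s =>
      (h s).trans_le (ciInf_le (Set.finite_range _).bddBelow i)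
    have hup : ∀ s, w i s + b ≤ lam l + gen Bs l s := fun s =>
      (hb s).trans_le (ciInf_le (Set.finite_range _).bddBelow l)
    obtain rfl : l = m := by
      refine eq_of_gen_le hM.inj (by rw [hM.card, hM.card]) (a := mu i + lam l - b - c) hj ?_
        fun s => ?_
      · linarith [h j, hb j]
      · linarith [hlow s, hup s]
    refine ⟨i, c - mu i, funext fun s => le_antisymm ?_ ?_⟩
    · linarith [hup s, h j, hb j]
    · linarith [hlow s]
end
end
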